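/- arXiv:2311.04333 — 2 statements merged into one kernel-verified Lean document; each statement's English description precedes it below -/
import Mathlib

section
/- Let G be a finite simple graph, let S* be a densest subgraph of G with density ρ* = ρ(S*), and let k ∈ ℕ satisfy k ≤ ⌈ρ*⌉. If C is a maximal vertex subset with min-degree at least k (the k-core of G), then S* ⊆ C. -/
open Finset
open scoped Classical

variable {V : Type*}

/-- `degS G S v` is the degree of `v` in the subgraph of `G` induced by the vertex set `S`. -/
noncomputable def degS [Fintype V] (G : SimpleGraph V) (S : Finset V) (v : V) : ℕ :=
  (S.filter fun u => G.Adj v u).card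

/-- `edgeCount G S` is the number of edges of the subgraph of `G` induced by `S`. -/
noncomputable def edgeCount [Fintype V] (G : SimpleGraph V) (S : Finset V) : ℕ :=
  (G.edgeFinset.filter fun ed => ∀ v ∈ ed, v ∈ S).card

/-- `density G S` is the density `|E(G[S])| / |S|` of the induced subgraph `G[S]`, as a rational. -/
noncomputable def density [Fintype V] (G : SimpleGraph V) (S : Finset V) : ℚ :=
  (edgeCount G S : ℚ) / (S.card : ℚ)

theorem edgeCount_le_erase [Fintype V] (G : SimpleGraph V) (S : Finset V) (v : V) :
    edgeCount G S ≤ edgeCount G (S.erase v) + degS G S v := by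
  unfold edgeCount degS
  have hsub : (G.edgeFinset.filter fun ed => ∀ w ∈ ed, w ∈ S) ⊆
      (G.edgeFinset.filter fun ed => ∀ w ∈ ed, w ∈ S.erase v) ∪
        (S.filter fun u => G.Adj v u).image (fun u => s(v, u)) := by
    intro ed hed
    rw [Finset.mem_filter] at hed
    obtain ⟨h1, h2⟩ := hed
    rw [Finset.mem_union]
    by_cases hv : v ∈ ed
    · right
      obtain ⟨u, rfl⟩ := hv
      rw [SimpleGraph.mem_edgeFinset, SimpleGraph.mem_edgeSet] at h1
      exact Finset.mem_image.2
        ⟨u, Finset.mem_filter.2 ⟨h2 u (Sym2.mem_mk_right v u), h1⟩, rfl⟩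
    · left
      refine Finset.mem_filter.2 ⟨h1, fun w hw => Finset.mem_erase.2 ⟨?_, h2 w hw⟩⟩
      rintro rfl
      exact hv hw
  exact (Finset.card_le_card hsub).trans ((Finset.card_union_le _ _).trans
    (Nat.add_le_add_left Finset.card_image_le _))

theorem degS_mono [Fintype V] (G : SimpleGraph V) {S T : Finset V} (h : S ⊆ T) (v : V) :
    degS G S v ≤ degS G T v :=
  Finset.card_le_card (Finset.filter_subset_filter _ h)

theorem density_le_degS [Fintype V] (G : SimpleGraph V) (S : Finset V)
    (hmax : ∀ T : Finset V, T.Nonempty → density G T ≤ density G S)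
    (v : V) (hv : v ∈ S) : density G S ≤ (degS G S v : ℚ) := by
  have h1 : (edgeCount G S : ℚ) ≤ edgeCount G (S.erase v) + degS G S v := by
    exact_mod_cast edgeCount_le_erase G S v
  have hcard : ((S.erase v).card : ℚ) + 1 = S.card := by
    exact_mod_cast Finset.card_erase_add_one hv
  have hpos : (0 : ℚ) < S.card := by
    exact_mod_cast Finset.card_pos.2 ⟨v, hv⟩
  have h2 : (edgeCount G S : ℚ) = density G S * S.card := by
    unfold density
    field_simp
  have h3 : (edgeCount G (S.erase v) : ℚ) ≤ density G S * (S.erase v).card := by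
    rcases (S.erase v).eq_empty_or_nonempty with he | he
    · have h0 : edgeCount G (∅ : Finset V) = 0 := by
        unfold edgeCount
        rw [Finset.card_eq_zero, Finset.filter_eq_empty_iff]
        intro ed _ h
        induction ed with
        | _ a b => exact absurd (h a (Sym2.mem_mk_left a b)) (Finset.notMem_empty a)
      rw [he, h0]
      simp
    · have hp : (0 : ℚ) < (S.erase v).card := by
        exact_mod_cast Finset.card_pos.2 he
      have := hmax _ he
      rw [density, div_le_iff₀ hp] at this
      exact this
  rw [← hcard] at h2
  linarith

/-- If `k ≤ ⌈ρ*⌉` and `C` is the `k`-core of `G` (a maximal subset with min-degree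
at least `k`), then every densest subgraph is contained in `C`. -/
theorem densest_subgraph_subset_kcore
    [Fintype V] (G : SimpleGraph V) (Sstar : Finset V) (hne : Sstar.Nonempty)
    (hmax : ∀ S : Finset V, S.Nonempty → density G S ≤ density G Sstar)
    (k : ℕ) (hk : (k : ℤ) ≤ ⌈density G Sstar⌉)
    (C : Finset V) (hC : ∀ v ∈ C, k ≤ degS G C v)
    (hCmax : ∀ T : Finset V, (∀ v ∈ T, k ≤ degS G T v) → C ⊆ T → T = C) :
    Sstar ⊆ C := by
  have hdeg : ∀ v ∈ Sstar, k ≤ degS G Sstar v := by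
    intro v hv
    have h := density_le_degS G Sstar hmax v hv
    have h' : ⌈density G Sstar⌉ ≤ (degS G Sstar v : ℤ) := Int.ceil_le.2 (by exact_mod_cast h)
    exact_mod_cast hk.trans h'
  have hT := hCmax (C ∪ Sstar) (by
    intro v hv
    rcases Finset.mem_union.1 hv with h | h
    · exact (hC v h).trans (degS_mono G Finset.subset_union_left v)
    · exact (hdeg v h).trans (degS_mono G Finset.subset_union_right v))
    Finset.subset_union_left
  rw [← hT]
  exact Finset.subset_union_right
end

section
/- Let G be a finite simple graph with at least one edge, let k_max be the largest k such that the k-core of G is nonempty, and let C be the k_max-core of G. Then ρ* ≤ 2·ρ(C); that is, the k_max-core is a 2-approximate densest subgraph of G. -/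
open Finset
open scoped Classical

variable {V : Type*}

/-- The degree in `S` counts the edges of `G[S]` at `v`. -/
lemma degS_eq_card [Fintype V] (G : SimpleGraph V) (S : Finset V) (v : V) (hv : v ∈ S) :
    degS G S v =
      ((G.edgeFinset.filter fun ed => ∀ v ∈ ed, v ∈ S).filter fun ed => v ∈ ed).card := by
  unfold degS
  apply Finset.card_bij (fun u _ => s(v, u))
  · intro u hu
    simp only [Finset.mem_filter] at hu
    simp [hu.1, hu.2, hv]
  · intro a _ b _ hab
    exact Sym2.congr_right.mp hab
  · intro e he
    simp only [Finset.mem_filter, SimpleGraph.mem_edgeFinset] at he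
    obtain ⟨⟨h1, h2⟩, h3⟩ := he
    obtain ⟨u, rfl⟩ := Sym2.mem_iff_exists.mp h3
    refine ⟨u, ?_, rfl⟩
    simp only [Finset.mem_filter]
    exact ⟨h2 u (by simp), h1⟩

lemma edgeCount_erase [Fintype V] (G : SimpleGraph V) (S : Finset V) (v : V) (hv : v ∈ S) :
    degS G S v + edgeCount G (S.erase v) = edgeCount G S := by
  rw [degS_eq_card G S v hv]
  unfold edgeCount
  rw [← Finset.card_filter_add_card_filter_not
    (s := G.edgeFinset.filter fun ed => ∀ v ∈ ed, v ∈ S) (fun ed => v ∈ ed)]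
  congr 2
  ext e
  simp only [Finset.mem_filter, Finset.mem_erase]
  grind

lemma sum_degS [Fintype V] (G : SimpleGraph V) (S : Finset V) :
    ∑ v ∈ S, degS G S v = 2 * edgeCount G S := by
  rw [Finset.sum_congr rfl (fun v hv => degS_eq_card G S v hv)]
  unfold edgeCount
  have h := Finset.sum_card_bipartiteAbove_eq_sum_card_bipartiteBelow (s := S)
    (t := G.edgeFinset.filter fun ed => ∀ v ∈ ed, v ∈ S) (fun v ed => v ∈ ed)
  unfold Finset.bipartiteAbove Finset.bipartiteBelow at h
  rw [h, Finset.sum_const_nat (m := 2), mul_comm]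
  intro e he
  simp only [Finset.mem_filter, SimpleGraph.mem_edgeFinset] at he
  obtain ⟨h1, h2⟩ := he
  rw [← Sym2.card_toFinset_of_not_isDiag e (G.not_isDiag_of_mem_edgeSet h1)]
  congr 1
  ext x
  simp only [Finset.mem_filter, Sym2.mem_toFinset]
  grind

/-- The `kmax`-core is a 2-approximate densest subgraph: `ρ* ≤ 2·ρ(C)` where `C` is the
`kmax`-core and `kmax` is the largest `k` with nonempty `k`-core. -/
theorem kmax_core_two_approx
    [Fintype V] (G : SimpleGraph V) (hE : ∃ u v : V, G.Adj u v)
    (kmax : ℕ)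
    (hk1 : ∃ C : Finset V, C.Nonempty ∧ ∀ v ∈ C, kmax ≤ degS G C v)
    (hk2 : ∀ k : ℕ, (∃ C : Finset V, C.Nonempty ∧ ∀ v ∈ C, k ≤ degS G C v) → k ≤ kmax)
    (Sstar : Finset V) (hne : Sstar.Nonempty)
    (hmax : ∀ S : Finset V, S.Nonempty → density G S ≤ density G Sstar)
    (C : Finset V) (hC : ∀ v ∈ C, kmax ≤ degS G C v)
    (hCmax : ∀ T : Finset V, (∀ v ∈ T, kmax ≤ degS G T v) → C ⊆ T → T = C) :
    density G Sstar ≤ 2 * density G C := by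
  have hCne : C.Nonempty := by
    rw [Finset.nonempty_iff_ne_empty]
    rintro rfl
    obtain ⟨T, hT, hT2⟩ := hk1
    exact hT.ne_empty (hCmax T hT2 (Finset.empty_subset _))
  have hdeg : ∀ v ∈ Sstar, density G Sstar ≤ (degS G Sstar v : ℚ) := by
    intro v hv
    have he := edgeCount_erase G Sstar v hv
    have hcard := Finset.card_erase_add_one hv
    have hpos : (0 : ℚ) < Sstar.card := by exact_mod_cast hne.card_pos
    have heq : density G Sstar * Sstar.card = edgeCount G Sstar := by
      unfold density
      field_simp
    have hle : (edgeCount G (Sstar.erase v) : ℚ) ≤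
        density G Sstar * (Sstar.erase v).card := by
      rcases (Sstar.erase v).eq_empty_or_nonempty with h0 | h0
      · have h1 := sum_degS G (Sstar.erase v)
        rw [h0] at h1 ⊢
        have h2 : edgeCount G (∅ : Finset V) = 0 := by simpa using h1.symm
        simp [h2]
      · have h1 := hmax _ h0
        have h2 : (0 : ℚ) < (Sstar.erase v).card := by exact_mod_cast h0.card_pos
        rw [density, div_le_iff₀ h2] at h1
        exact h1
    have he' : (degS G Sstar v : ℚ) + edgeCount G (Sstar.erase v) = edgeCount G Sstar := by
      exact_mod_cast he
    have hc' : ((Sstar.erase v).card : ℚ) + 1 = Sstar.card := by exact_mod_cast hcard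
    rw [← hc'] at heq
    linarith
  have hk : ⌈density G Sstar⌉₊ ≤ kmax :=
    hk2 _ ⟨Sstar, hne, fun v hv => Nat.ceil_le.mpr (hdeg v hv)⟩
  have hk' : density G Sstar ≤ (kmax : ℚ) := Nat.ceil_le.mp hk
  refine hk'.trans ?_
  have hpos : (0 : ℚ) < C.card := by exact_mod_cast hCne.card_pos
  have hs : C.card * kmax ≤ 2 * edgeCount G C := by
    rw [← sum_degS, ← smul_eq_mul]
    exact Finset.card_nsmul_le_sum _ _ _ hC
  have hs' : (C.card : ℚ) * kmax ≤ 2 * edgeCount G C := by exact_mod_cast hs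
  unfold density
  rw [← mul_div_assoc, le_div_iff₀ hpos]
  linarith
end
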